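/- Let V, W be complex vector spaces of dimensions n and m with n ≤ m, and let f : V → W be a ℂ-linear map. Consider the linear map d : Hom(Sym^{m−n}V, V) ⊕ Hom(Sym^{m−n−1}V, 𝔰𝔩(W)) → Hom(Sym^{m−n}V, W) given by d(a, b) = f ∘ a + b ⊙ f. Then the cokernel of d is isomorphic as a ℂ-vector space to Hom(Sym^{m−n}(ker f), coker f), via the map induced by restricting a morphism η ∈ Hom(Sym^{m−n}V, W) to Sym^{m−n}(ker f) and composing with the projection W → coker f. -/

import Mathlib

open scoped TensorProduct

noncomputable section

/-- The relations submodule defining the `k`-th symmetric power. -/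
def SymPow.rel (R : Type*) [CommRing R] (N : Type*) [AddCommGroup N] [Module R N]
    (k : ℕ) : Submodule R (⨂[R]^k N) :=
  Submodule.span R {x | ∃ (v : Fin k → N) (e : Equiv.Perm (Fin k)),
    x = PiTensorProduct.tprod R v - PiTensorProduct.tprod R (v ∘ e)}

/-- The `k`-th symmetric power `Sym^k N` of an `R`-module `N`. -/
abbrev SymPow (R : Type*) [CommRing R] (N : Type*) [AddCommGroup N] [Module R N]
    (k : ℕ) : Type _ :=
  (⨂[R]^k N) ⧸ SymPow.rel R N k

/-- The product `v₁ ⋯ v_k` of a family of vectors, as an element of `Sym^k N`. -/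
def SymPow.mk (R : Type*) [CommRing R] {N : Type*} [AddCommGroup N] [Module R N]
    (k : ℕ) (v : Fin k → N) : SymPow R N k :=
  Submodule.Quotient.mk (PiTensorProduct.tprod R v)

/-- For `i : Fin k`, the increasing bijection `Fin (k-1) → Fin k ∖ {i}`, used to omit the
`i`-th entry of a family. -/
def omitAt {k : ℕ} (i : Fin k) (a : Fin (k - 1)) : Fin k :=
  ⟨if (a : ℕ) < (i : ℕ) then (a : ℕ) else (a : ℕ) + 1,
    by have ha := a.isLt; have hi := i.isLt; split <;> omega⟩

/-- `Sym^k(ker f)`, i.e. the image of the natural map `Sym^k(ker f) → Sym^k V` induced by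
the inclusion `ker f ⊆ V`: the subspace spanned by products of vectors of `ker f`. -/
def symKerImage {V W : Type*} [AddCommGroup V] [Module ℂ V] [AddCommGroup W] [Module ℂ W]
    (f : V →ₗ[ℂ] W) (k : ℕ) : Submodule ℂ (SymPow ℂ V k) :=
  Submodule.span ℂ {x | ∃ v : Fin k → V, (∀ i, v i ∈ LinearMap.ker f) ∧ x = SymPow.mk ℂ k v}

namespace SymPow

section Lift

variable {R : Type*} [CommRing R] {N P : Type*} [AddCommGroup N] [Module R N]
  [AddCommGroup P] [Module R P] {k : ℕ}

/-- The product `v₁ ⋯ v_k` as a multilinear map. -/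
def mkMultilinear (R : Type*) [CommRing R] (N : Type*) [AddCommGroup N] [Module R N] (k : ℕ) :
    MultilinearMap R (fun _ : Fin k => N) (SymPow R N k) :=
  (SymPow.rel R N k).mkQ.compMultilinearMap (PiTensorProduct.tprod R)

@[simp]
theorem mkMultilinear_apply (v : Fin k → N) : mkMultilinear R N k v = mk R k v :=
  rfl

theorem mk_comp_perm (v : Fin k → N) (e : Equiv.Perm (Fin k)) : mk R k (v ∘ e) = mk R k v :=
  ((Submodule.Quotient.eq (SymPow.rel R N k)).2 (Submodule.subset_span ⟨v, e, rfl⟩)).symm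

theorem hom_ext {g h : SymPow R N k →ₗ[R] P} (H : ∀ v, g (mk R k v) = h (mk R k v)) : g = h :=
  Submodule.linearMap_qext _ (PiTensorProduct.ext (MultilinearMap.ext H))

/-- The linear map on `Sym^k N` induced by a symmetric multilinear map. -/
def lift (M : MultilinearMap R (fun _ : Fin k => N) P)
    (hM : ∀ (v : Fin k → N) (e : Equiv.Perm (Fin k)), M (v ∘ e) = M v) :
    SymPow R N k →ₗ[R] P :=
  (SymPow.rel R N k).liftQ (PiTensorProduct.lift M) <| by
    refine Submodule.span_le.2 ?_
    rintro _ ⟨v, e, rfl⟩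
    simp [hM]

@[simp]
theorem lift_mk (M : MultilinearMap R (fun _ : Fin k => N) P)
    (hM : ∀ (v : Fin k → N) (e : Equiv.Perm (Fin k)), M (v ∘ e) = M v) (v : Fin k → N) :
    lift M hM (mk R k v) = M v :=
  PiTensorProduct.lift.tprod v

theorem mk_snoc_comp_succAbove (w : Fin (k + 1) → N) (i : Fin (k + 1)) :
    mk R (k + 1) (Fin.snoc (fun a => w (i.succAbove a)) (w i)) = mk R (k + 1) w := by
  have hbij : Function.Bijective
      (Fin.snoc (α := fun _ => Fin (k + 1)) i.succAbove i) := by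
    refine Finite.injective_iff_bijective.1 ?_
    refine Fin.snoc_injective_iff.2 ⟨Fin.succAbove_right_injective, ?_⟩
    rintro ⟨a, ha⟩
    exact Fin.succAbove_ne i a ha
  rw [← mk_comp_perm w (Equiv.ofBijective _ hbij)]
  congr 1
  funext a
  refine Fin.lastCases ?_ (fun a => ?_) a <;> simp

end Lift

end SymPow

theorem omitAt_succ {k : ℕ} (i : Fin (k + 1)) (a : Fin k) : omitAt i a = i.succAbove a := by
  ext
  simp only [omitAt, Fin.succAbove, Fin.lt_def, Fin.val_castSucc]
  split <;> simp

/-- Every linear map of vector spaces has a reflexive generalized inverse. -/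
theorem LinearMap.exists_reflexive_generalized_inverse {K V W : Type*} [Field K] [AddCommGroup V]
    [Module K V] [AddCommGroup W] [Module K W] (f : V →ₗ[K] W) :
    ∃ s : W →ₗ[K] V, (∀ v, f (s (f v)) = f v) ∧ ∀ w, s (f (s w)) = s w := by
  obtain ⟨g, hg⟩ := f.rangeRestrict.exists_rightInverse_of_surjective f.range_rangeRestrict
  obtain ⟨t, ht⟩ := LinearMap.exists_extend g
  have key : ∀ v, f (t (f v)) = f v := fun v => by
    have h1 : t (f v) = g (f.rangeRestrict v) := LinearMap.congr_fun ht (f.rangeRestrict v)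
    rw [h1]
    exact congrArg Subtype.val (LinearMap.congr_fun hg (f.rangeRestrict v))
  exact ⟨t ∘ₗ f ∘ₗ t, by simp [key], by simp [key]⟩

/-- Subsets of `Fin (k + 1)` containing `i` correspond to subsets of `Fin k`. -/
theorem Finset.sum_insert_map_succAbove {A : Type*} [AddCommMonoid A] {k : ℕ} (i : Fin (k + 1))
    (F : Finset (Fin (k + 1)) → A) :
    ∑ S : Finset (Fin k), F (insert i (S.map i.succAboveEmb)) =
      ∑ T : Finset (Fin (k + 1)), if i ∈ T then F T else 0 := by
  rw [← Finset.sum_filter]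
  refine Finset.sum_bij' (fun S _ => insert i (S.map i.succAboveEmb))
    (fun T _ => Finset.univ.filter fun a => i.succAbove a ∈ T) (by simp) (by simp) ?_ ?_
    (by simp)
  · intro S _
    ext a
    simp [Fin.succAbove_ne]
  · intro T hT
    ext x
    have hi : i ∈ T := by simpa using hT
    refine Fin.succAboveCases i ?_ (fun a => ?_) x <;> simp [hi, Fin.succAbove_ne]

/-- A weighted sum of all values `H T`, with `T` counted once for each of its elements. -/
theorem sum_sum_insert_map_succAbove_smul {A : Type*} [AddCommGroup A] [Module ℂ A] {k : ℕ}
    (H : Finset (Fin (k + 1)) → A) :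
    ∑ i : Fin (k + 1), ∑ S : Finset (Fin k),
        ((S.card + 1 : ℂ)⁻¹) • H (insert i (S.map i.succAboveEmb)) =
      (∑ T, H T) - H ∅ := by
  have h1 : ∀ i : Fin (k + 1), ∑ S : Finset (Fin k),
      ((S.card + 1 : ℂ)⁻¹) • H (insert i (S.map i.succAboveEmb)) =
      ∑ T : Finset (Fin (k + 1)), if i ∈ T then (T.card : ℂ)⁻¹ • H T else 0 := fun i => by
    rw [← Finset.sum_insert_map_succAbove i fun T => (T.card : ℂ)⁻¹ • H T]
    refine Finset.sum_congr rfl fun S _ => ?_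
    rw [Finset.card_insert_of_notMem (by simp [Fin.succAbove_ne])]
    simp
  simp_rw [h1]
  rw [Finset.sum_comm, ← Finset.sum_erase_eq_sub (Finset.mem_univ ∅),
    ← Finset.sum_erase Finset.univ (a := ∅) (by simp)]
  refine Finset.sum_congr rfl fun T hT => ?_
  have hT' : (T.card : ℂ) ≠ 0 := by simpa using hT
  rw [← Finset.sum_filter, Finset.sum_const, Finset.filter_univ_mem, ← Nat.cast_smul_eq_nsmul ℂ,
    smul_smul, mul_inv_cancel₀ hT', one_smul]

section Polarization

variable {V W : Type*} [AddCommGroup V] [Module ℂ V] [AddCommGroup W] [Module ℂ W]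

/-- Expand `η (v₁ ⋯ v_k x)` along `v_i = p v_i + q v_i` and divide the summand with `j` factors
`p v_i` by `j + 1`. -/
def weightedCurry {k : ℕ} (p q : V →ₗ[ℂ] V) (η : SymPow ℂ V (k + 1) →ₗ[ℂ] W) :
    MultilinearMap ℂ (fun _ : Fin k => V) (V →ₗ[ℂ] W) :=
  ∑ S : Finset (Fin k), ((S.card + 1 : ℂ)⁻¹) •
    (η.compMultilinearMap (SymPow.mkMultilinear ℂ V (k + 1))).curryRight.compLinearMap
      fun i => if i ∈ S then p else q

theorem weightedCurry_apply {k : ℕ} (p q : V →ₗ[ℂ] V) (η : SymPow ℂ V (k + 1) →ₗ[ℂ] W)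
    (v : Fin k → V) (x : V) :
    weightedCurry p q η v x = ∑ S : Finset (Fin k), ((S.card + 1 : ℂ)⁻¹) •
      η (SymPow.mk ℂ (k + 1) (Fin.snoc (fun i => if i ∈ S then p (v i) else q (v i)) x)) := by
  simp only [weightedCurry, sum_apply, LinearMap.sum_apply,
    smul_apply, LinearMap.smul_apply, MultilinearMap.compLinearMap_apply,
    MultilinearMap.curryRight_apply, LinearMap.compMultilinearMap_apply,
    SymPow.mkMultilinear_apply]
  refine Finset.sum_congr rfl fun S _ => ?_
  congr! 5 with i
  split_ifs <;> rfl

theorem weightedCurry_comp_perm {k : ℕ} (p q : V →ₗ[ℂ] V) (η : SymPow ℂ V (k + 1) →ₗ[ℂ] W)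
    (v : Fin k → V) (e : Equiv.Perm (Fin k)) :
    weightedCurry p q η (v ∘ e) = weightedCurry p q η v := by
  ext x
  rw [weightedCurry_apply, weightedCurry_apply]
  symm
  rw [← Equiv.sum_comp e.finsetCongr]
  refine Finset.sum_congr rfl fun S _ => ?_
  have hperm : Function.Bijective
      (Fin.snoc (α := fun _ => Fin (k + 1)) (fun a => (e a).castSucc) (Fin.last k)) := by
    refine Finite.injective_iff_bijective.1 (Fin.snoc_injective_iff.2 ⟨?_, ?_⟩)
    · exact (Fin.castSucc_injective k).comp e.injective
    · rintro ⟨a, ha⟩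
      exact (Fin.castSucc_lt_last _).ne ha
  rw [← SymPow.mk_comp_perm (Fin.snoc (fun i => if i ∈ e.finsetCongr S then p (v i) else q (v i)) x)
    (Equiv.ofBijective _ hperm)]
  congr 3
  · simp
  · funext a
    refine Fin.lastCases ?_ (fun a => ?_) a <;> simp

theorem sum_weightedCurry {k : ℕ} (p q : V →ₗ[ℂ] V) (hpq : ∀ v, p v + q v = v)
    (η : SymPow ℂ V (k + 1) →ₗ[ℂ] W) (v : Fin (k + 1) → V) :
    ∑ i, weightedCurry p q η (fun a => v (i.succAbove a)) (p (v i)) =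
      η (SymPow.mk ℂ (k + 1) v) - η (SymPow.mk ℂ (k + 1) fun i => q (v i)) := by
  let H : Finset (Fin (k + 1)) → W := fun T =>
    η (SymPow.mk ℂ (k + 1) (T.piecewise (fun i => p (v i)) fun i => q (v i)))
  have hsum : ∑ T, H T = η (SymPow.mk ℂ (k + 1) v) := by
    have h := (η.compMultilinearMap (SymPow.mkMultilinear ℂ V (k + 1))).map_add_univ
      (fun i => p (v i)) fun i => q (v i)
    rw [show ((fun i => p (v i)) + fun i => q (v i)) = v from funext fun i => hpq (v i)] at h
    exact h.symm
  have hempty : H ∅ = η (SymPow.mk ℂ (k + 1) fun i => q (v i)) := by simp [H]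
  rw [← hsum, ← hempty, ← sum_sum_insert_map_succAbove_smul]
  refine Finset.sum_congr rfl fun i _ => ?_
  rw [weightedCurry_apply]
  refine Finset.sum_congr rfl fun S _ => ?_
  dsimp only [H]
  conv_rhs => rw [← SymPow.mk_snoc_comp_succAbove _ i]
  simp [Finset.piecewise, Fin.succAbove_ne]

/-- `g ↦ c ∘ g ∘ s`, with values in the traceless endomorphisms when `s ∘ c = 0`. -/
def tracelessSandwich [FiniteDimensional ℂ V] [FiniteDimensional ℂ W]
    (s : W →ₗ[ℂ] V) (c : W →ₗ[ℂ] W) (hsc : s ∘ₗ c = 0) :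
    (V →ₗ[ℂ] W) →ₗ[ℂ] LinearMap.ker (LinearMap.trace ℂ W) :=
  LinearMap.codRestrict _ (LinearMap.lcomp ℂ W s ∘ₗ LinearMap.llcomp ℂ V W W c) fun g => by
    change LinearMap.trace ℂ W ((c ∘ₗ g) ∘ₗ s) = 0
    rw [LinearMap.trace_comp_comm', ← LinearMap.comp_assoc, hsc, LinearMap.zero_comp, map_zero]

@[simp]
theorem tracelessSandwich_apply [FiniteDimensional ℂ V] [FiniteDimensional ℂ W]
    (s : W →ₗ[ℂ] V) (c : W →ₗ[ℂ] W) (hsc : s ∘ₗ c = 0) (g : V →ₗ[ℂ] W) (w : W) :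
    (tracelessSandwich s c hsc g).val w = c (g (s w)) :=
  rfl

/-- If `c` kills the range of `f` and `η` maps `Sym^k(ker f)` into it, then `c ∘ η` is of the
form `b ⊙ f`. -/
theorem exists_odot_eq [FiniteDimensional ℂ V] [FiniteDimensional ℂ W] (f : V →ₗ[ℂ] W)
    (s : W →ₗ[ℂ] V) (c : W →ₗ[ℂ] W) (hfsf : ∀ v, f (s (f v)) = f v) (hsc : s ∘ₗ c = 0) (k : ℕ)
    (η : SymPow ℂ V k →ₗ[ℂ] W)
    (hη : ∀ v : Fin k → V, (∀ i, f (v i) = 0) → c (η (SymPow.mk ℂ k v)) = 0) :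
    ∃ b : SymPow ℂ V (k - 1) →ₗ[ℂ] LinearMap.ker (LinearMap.trace ℂ W), ∀ v : Fin k → V,
      ∑ i, (b (SymPow.mk ℂ (k - 1) fun a => v (omitAt i a))).val (f (v i)) =
        c (η (SymPow.mk ℂ k v)) := by
  cases k with
  | zero => exact ⟨0, fun v => by simp [hη v finZeroElim]⟩
  | succ k =>
    let p : V →ₗ[ℂ] V := s ∘ₗ f
    let q : V →ₗ[ℂ] V := LinearMap.id - p
    let M := weightedCurry p q η
    refine ⟨SymPow.lift ((tracelessSandwich s c hsc).compMultilinearMap M) fun v e =>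
      congrArg (tracelessSandwich s c hsc) (weightedCurry_comp_perm p q η v e), fun v => ?_⟩
    calc
      _ = ∑ i, c (M (fun a => v (i.succAbove a)) (p (v i))) := by
        refine Finset.sum_congr rfl fun i _ => ?_
        simp only [omitAt_succ]
        erw [SymPow.lift_mk]
        rfl
      _ = c (η (SymPow.mk ℂ (k + 1) v)) := by
        rw [← map_sum, sum_weightedCurry p q (by simp [q]), map_sub,
          hη (fun i => q (v i)) fun i => by simp [q, p, hfsf], sub_zero]

end Polarization

/-- Let `V`, `W` be complex vector spaces of dimensions `n ≤ m` and
`f : V → W` a linear map. Consider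
`d : Hom(Sym^{m-n}V, V) ⊕ Hom(Sym^{m-n-1}V, 𝔰𝔩(W)) → Hom(Sym^{m-n}V, W)`,
`d(a, b) = f ∘ a + b ⊙ f`. Then the cokernel of `d` is isomorphic as a `ℂ`-vector space to
`Hom(Sym^{m-n}(ker f), coker f)`, via the map `Φ` induced by restricting a morphism
`η ∈ Hom(Sym^{m-n}V, W)` to `Sym^{m-n}(ker f)` and composing with the projection
`W → coker f`; that is, `Φ` is surjective with kernel equal to the image of `d`. -/
theorem coker_of_comp_plus_odot_iso_hom_symKer_coker
    {V W : Type*} [AddCommGroup V] [Module ℂ V] [AddCommGroup W] [Module ℂ W]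
    [FiniteDimensional ℂ V] [FiniteDimensional ℂ W] (n m : ℕ)
    (hV : Module.finrank ℂ V = n) (hW : Module.finrank ℂ W = m) (hnm : n ≤ m)
    (f : V →ₗ[ℂ] W)
    (odot : (SymPow ℂ V (m-n-1) →ₗ[ℂ] (LinearMap.ker (LinearMap.trace ℂ W))) →
      (SymPow ℂ V (m-n) →ₗ[ℂ] W))
    (hodot : ∀ (b : SymPow ℂ V (m-n-1) →ₗ[ℂ] (LinearMap.ker (LinearMap.trace ℂ W)))
      (v : Fin (m-n) → V),
      odot b (SymPow.mk ℂ (m-n) v)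
        = ∑ i : Fin (m-n),
            (b (SymPow.mk ℂ (m-n-1) (fun a : Fin (m-n-1) => v (omitAt i a)))).val
              (f (v i)))
    (d : ((SymPow ℂ V (m-n) →ₗ[ℂ] V) ×
        (SymPow ℂ V (m-n-1) →ₗ[ℂ] (LinearMap.ker (LinearMap.trace ℂ W)))) →ₗ[ℂ]
      (SymPow ℂ V (m-n) →ₗ[ℂ] W))
    (hd : ∀ (a : SymPow ℂ V (m-n) →ₗ[ℂ] V)
      (b : SymPow ℂ V (m-n-1) →ₗ[ℂ] (LinearMap.ker (LinearMap.trace ℂ W))),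
      d (a, b) = f ∘ₗ a + odot b)
    (Φ : (SymPow ℂ V (m-n) →ₗ[ℂ] W) →ₗ[ℂ]
      ((symKerImage f (m-n)) →ₗ[ℂ] (W ⧸ LinearMap.range f)))
    (hΦ : ∀ (η : SymPow ℂ V (m-n) →ₗ[ℂ] W) (x : symKerImage f (m-n)),
      Φ η x = (LinearMap.range f).mkQ (η x.val)) :
    Function.Surjective Φ ∧ LinearMap.ker Φ = LinearMap.range d := by
  constructor
  · intro g
    obtain ⟨r, hr⟩ := (LinearMap.range f).mkQ.exists_rightInverse_of_surjective
      (Submodule.range_mkQ _)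
    obtain ⟨η, hη⟩ := LinearMap.exists_extend (r ∘ₗ g)
    refine ⟨η, LinearMap.ext fun x => ?_⟩
    rw [hΦ, show η x.val = r (g x) from LinearMap.congr_fun hη x]
    exact LinearMap.congr_fun hr (g x)
  · have hmem : ∀ η, η ∈ LinearMap.ker Φ ↔ ∀ v : Fin (m-n) → V, (∀ i, f (v i) = 0) →
        η (SymPow.mk ℂ (m-n) v) ∈ LinearMap.range f := fun η => by
      constructor
      · intro h v hv
        have hx := hΦ η ⟨SymPow.mk ℂ (m-n) v, Submodule.subset_span ⟨v, hv, rfl⟩⟩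
        rw [LinearMap.mem_ker.1 h, LinearMap.zero_apply] at hx
        simpa using hx.symm
      · intro h
        have hle : symKerImage f (m-n) ≤ (LinearMap.range f).comap η := by
          refine Submodule.span_le.2 ?_
          rintro _ ⟨v, hv, rfl⟩
          exact h v hv
        refine LinearMap.mem_ker.2 (LinearMap.ext fun x => ?_)
        rw [hΦ, LinearMap.zero_apply, Submodule.mkQ_apply, Submodule.Quotient.mk_eq_zero]
        exact hle x.2
    apply le_antisymm
    · intro η hη
      obtain ⟨s, hfsf, hsfs⟩ := f.exists_reflexive_generalized_inverse
      let c : W →ₗ[ℂ] W := LinearMap.id - f ∘ₗ s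
      have hsc : s ∘ₗ c = 0 := LinearMap.ext fun w => by simp [c, hsfs]
      obtain ⟨b, hb⟩ := exists_odot_eq f s c hfsf hsc (m-n) η fun v hv => by
        obtain ⟨x, hx⟩ := (hmem η).1 hη v hv
        simp [← hx, c, hfsf]
      refine ⟨(s ∘ₗ η, b), ?_⟩
      rw [hd]
      refine SymPow.hom_ext fun v => ?_
      rw [LinearMap.add_apply, hodot, hb]
      simp [c]
    · rintro _ ⟨⟨a, b⟩, rfl⟩
      refine (hmem _).2 fun v hv => ?_
      rw [hd, LinearMap.add_apply, hodot]
      simp [hv]
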